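/- Let a ≥ 0, b ≥ 1 and let E ⊆ ⋃_{n≥1} B_n^{a,b} be an identity block. Then: (a) lim_n θ_n(E) = 0 if and only if there exists 1 < p < ∞ with sup_n α_{p,n}(E) < ∞; and (b) lim_n υ_n(E) = 0 if and only if there exists 1 < q < ∞ with sup_n β_{q,n}(E) < ∞. (That is, an identity block has block basic subtype iff it has nontrivial block basic type, and block basic subcotype iff it has nontrivial block basic cotype.) -/

import Mathlib

open scoped BigOperators ENNReal

noncomputable section

namespace AsymSeminorms

variable {𝕜 : Type*} [RCLike 𝕜]

/-- A pair of seminorms on `𝕜^n`, used to encode a (finite) basic sequence together with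
the seminorm induced by an operator. -/
abbrev SNPair (𝕜 : Type*) [RCLike 𝕜] (n : ℕ) : Type _ :=
  Seminorm 𝕜 (Fin n → 𝕜) × Seminorm 𝕜 (Fin n → 𝕜)

/-- Truncation of a vector in `𝕜^n` to its first `m` coordinates (the rest set to `0`);
this encodes `∑_{i=1}^m a_i e_i`. -/
def trunc {n : ℕ} (m : ℕ) (a : Fin n → 𝕜) : Fin n → 𝕜 :=
  fun i => if (i : ℕ) < m then a i else 0

/-- Membership in the set `B_n^{a,b}` (here the constants are called `ca`, `cb`):
`r = P.1` is a norm with `r(e_i) = 1`, both seminorms satisfy the `b`-basis inequality for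
truncations, and `ρ = P.2` satisfies `ρ ≤ a·r`. -/
structure MemB (ca cb : ℝ) {n : ℕ} (P : SNPair 𝕜 n) : Prop where
  eq_zero_of : ∀ x : Fin n → 𝕜, P.1 x = 0 → x = 0
  single_eq_one : ∀ i : Fin n, P.1 (Pi.single i 1) = 1
  trunc_fst : ∀ m : ℕ, m ≤ n → ∀ a : Fin n → 𝕜, P.1 (trunc m a) ≤ cb * P.1 a
  trunc_snd : ∀ m : ℕ, m ≤ n → ∀ a : Fin n → 𝕜, P.2 (trunc m a) ≤ cb * P.2 a
  snd_le : ∀ x : Fin n → 𝕜, P.2 x ≤ ca * P.1 x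

/-- The metric `d_n` on `B_n^{a,b}`: the supremum, over coefficient vectors in the unit ball
of `ℓ_∞^n`, of the maximal deviation of the two seminorms. -/
def dB {n : ℕ} (P Q : SNPair 𝕜 n) : ℝ :=
  sSup {x : ℝ | ∃ a : Fin n → 𝕜, (∀ i, ‖a i‖ ≤ 1) ∧
      x = max |P.1 a - Q.1 a| |P.2 a - Q.2 a|}

/-- A family `E`, with `E n` a set of pairs of seminorms on `𝕜^n`; this encodes a subset of
`⋃_{n≥1} B_n^{a,b}`. -/
abbrev Fam (𝕜 : Type*) [RCLike 𝕜] : Type _ := ∀ n : ℕ, Set (SNPair 𝕜 n)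

/-- `E ⊆ ⋃_n B_n^{a,b}`. -/
def SubB (ca cb : ℝ) (E : Fam 𝕜) : Prop := ∀ n, ∀ P ∈ E n, MemB ca cb P

/-- `E` is closed: each `E ∩ B_n^{a,b}` is closed in `B_n^{a,b}` for the metric `d_n`. -/
def ClosedFam (ca cb : ℝ) (E : Fam 𝕜) : Prop :=
  ∀ n, ∀ P : SNPair 𝕜 n, MemB ca cb P →
    (∀ ε : ℝ, 0 < ε → ∃ Q ∈ E n, dB P Q < ε) → P ∈ E n

/-- The `j`-th block piece: the vector `∑_{k_j < i ≤ k_{j+1}} a_i e_i` (with `0`-based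
indexing of the cut points `k`). -/
def piece {n m : ℕ} (a : Fin n → 𝕜) (k : Fin (m + 1) → ℕ) (j : Fin m) : Fin n → 𝕜 :=
  fun i => if k j.castSucc ≤ (i : ℕ) ∧ (i : ℕ) < k j.succ then a i else 0

/-- `(s,σ) = Q` is a block of `(r,ρ) = P`. -/
def IsBlockOf {n m : ℕ} (P : SNPair 𝕜 n) (Q : SNPair 𝕜 m) : Prop :=
  ∃ (a : Fin n → 𝕜) (k : Fin (m + 1) → ℕ),
    k 0 = 0 ∧ StrictMono k ∧ k (Fin.last m) ≤ n ∧
    (∀ j : Fin m, P.1 (piece a k j) = 1) ∧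
    (∀ b : Fin m → 𝕜, Q.1 b = P.1 (∑ j : Fin m, b j • piece a k j)) ∧
    (∀ b : Fin m → 𝕜, Q.2 b = P.2 (∑ j : Fin m, b j • piece a k j))

/-- `E` contains all blocks of its members (that lie in the corresponding `B_m^{a,b}`). -/
def BlockClosedFam (ca cb : ℝ) (E : Fam 𝕜) : Prop :=
  ∀ n m : ℕ, ∀ P ∈ E n, ∀ Q : SNPair 𝕜 m, MemB ca cb Q → IsBlockOf P Q → Q ∈ E m

/-- `E ⊆ ⋃_n B_n^{a,b}` is stable: closed and block closed. -/
def StableFam (ca cb : ℝ) (E : Fam 𝕜) : Prop :=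
  SubB ca cb E ∧ ClosedFam ca cb E ∧ BlockClosedFam ca cb E

/-- `E` is an identity block: stable and `r = ρ` for each member. -/
def IdentityBlockFam (ca cb : ℝ) (E : Fam 𝕜) : Prop :=
  StableFam ca cb E ∧ ∀ n, ∀ P ∈ E n, P.1 = P.2

/-- The `ℓ_p^n` norm of a coefficient vector, `1 ≤ p ≤ ∞`. -/
def lpnorm (p : ℝ≥0∞) {n : ℕ} (a : Fin n → 𝕜) : ℝ :=
  if p = ∞ then ⨆ i, ‖a i‖ else (∑ i, ‖a i‖ ^ p.toReal) ^ (1 / p.toReal)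

/-- The sign `±1 ∈ 𝕜` associated to a Boolean. -/
def sgn (b : Bool) : 𝕜 := if b then 1 else -1

/-- The `L_p` norm of a real function of `n` independent Rademacher variables, i.e. of a
function on `{±1}^n` with the uniform probability measure. -/
def radLp (p : ℝ≥0∞) {n : ℕ} (F : (Fin n → Bool) → ℝ) : ℝ :=
  if p = ∞ then ⨆ ε : Fin n → Bool, |F ε|
  else ((∑ ε : Fin n → Bool, |F ε| ^ p.toReal) / 2 ^ n) ^ (1 / p.toReal)

/-- `α_{p,n}(E)`: the infimum of the constants `T > 0` such that
`ρ(∑ a_i e_i) ≤ T ‖(a_i)‖_{ℓ_p^n}` for all `(r,ρ) ∈ E ∩ B_n^{a,b}`. -/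
def alphaC (p : ℝ≥0∞) (E : Fam 𝕜) (n : ℕ) : ℝ :=
  sInf {T : ℝ | 0 < T ∧ ∀ P ∈ E n, ∀ a : Fin n → 𝕜, P.2 a ≤ T * lpnorm p a}

/-- `β_{q,n}(E)`: the infimum of the constants `C > 0` such that
`C r(∑ a_i e_i) ≥ ‖(a_i ρ(e_i))‖_{ℓ_q^n}` for all `(r,ρ) ∈ E ∩ B_n^{a,b}`. -/
def betaC (q : ℝ≥0∞) (E : Fam 𝕜) (n : ℕ) : ℝ :=
  sInf {C : ℝ | 0 < C ∧ ∀ P ∈ E n, ∀ a : Fin n → 𝕜,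
    lpnorm q (fun i => a i * ((P.2 (Pi.single i 1) : ℝ) : 𝕜)) ≤ C * P.1 a}

/-- `τ_{p,n}(E)`: the infimum of the constants `T > 0` such that
`‖ρ(∑ ε_i a_i e_i)‖_{L_p} ≤ T ‖(a_i)‖_{ℓ_p^n}` for all `(r,ρ) ∈ E ∩ B_n^{a,b}`. -/
def tauC (p : ℝ≥0∞) (E : Fam 𝕜) (n : ℕ) : ℝ :=
  sInf {T : ℝ | 0 < T ∧ ∀ P ∈ E n, ∀ a : Fin n → 𝕜,
    radLp p (fun ε => P.2 (fun i => sgn (ε i) * a i)) ≤ T * lpnorm p a}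

/-- `γ_{q,n}(E)`: the infimum of the constants `C > 0` such that
`C ‖r(∑ ε_i a_i e_i)‖_{L_q} ≥ ‖(a_i ρ(e_i))‖_{ℓ_q^n}` for all `(r,ρ) ∈ E ∩ B_n^{a,b}`. -/
def gammaC (q : ℝ≥0∞) (E : Fam 𝕜) (n : ℕ) : ℝ :=
  sInf {C : ℝ | 0 < C ∧ ∀ P ∈ E n, ∀ a : Fin n → 𝕜,
    lpnorm q (fun i => a i * ((P.2 (Pi.single i 1) : ℝ) : 𝕜)) ≤
      C * radLp q (fun ε => P.1 (fun i => sgn (ε i) * a i))}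

/-- `θ_n(E)`: the infimum of the constants `T > 0` such that
`ρ((1/n) ∑ a_i e_i) ≤ T ‖(a_i)‖_{ℓ_∞^n}` for all `(r,ρ) ∈ E ∩ B_n^{a,b}`. -/
def thetaC (E : Fam 𝕜) (n : ℕ) : ℝ :=
  sInf {T : ℝ | 0 < T ∧ ∀ P ∈ E n, ∀ a : Fin n → 𝕜,
    P.2 ((n : 𝕜)⁻¹ • a) ≤ T * lpnorm ∞ a}

/-- `Θ_n(E)`: the infimum of the constants `T > 0` such that
`‖ρ((1/n) ∑ ε_i a_i e_i)‖_{L_1} ≤ T ‖(a_i)‖_{ℓ_∞^n}` for all `(r,ρ) ∈ E ∩ B_n^{a,b}`. -/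
def bigThetaC (E : Fam 𝕜) (n : ℕ) : ℝ :=
  sInf {T : ℝ | 0 < T ∧ ∀ P ∈ E n, ∀ a : Fin n → 𝕜,
    radLp 1 (fun ε => P.2 ((n : 𝕜)⁻¹ • fun i => sgn (ε i) * a i)) ≤ T * lpnorm ∞ a}

/-- `υ_n(E)`: the infimum of the constants `C > 0` such that
`C r(∑ a_i e_i) ≥ min_i |a_i| ρ(e_i)` for all `(r,ρ) ∈ E ∩ B_n^{a,b}`. -/
def upsC (E : Fam 𝕜) (n : ℕ) : ℝ :=
  sInf {C : ℝ | 0 < C ∧ ∀ P ∈ E n, ∀ a : Fin n → 𝕜,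
    (⨅ i, ‖a i‖ * P.2 (Pi.single i 1)) ≤ C * P.1 a}

/-- `Υ_n(E)`: the infimum of the constants `C > 0` such that
`C ‖r(∑ ε_i a_i e_i)‖_{L_1} ≥ min_i |a_i| ρ(e_i)` for all `(r,ρ) ∈ E ∩ B_n^{a,b}`. -/
def bigUpsC (E : Fam 𝕜) (n : ℕ) : ℝ :=
  sInf {C : ℝ | 0 < C ∧ ∀ P ∈ E n, ∀ a : Fin n → 𝕜,
    (⨅ i, ‖a i‖ * P.2 (Pi.single i 1)) ≤
      C * radLp 1 (fun ε => P.1 (fun i => sgn (ε i) * a i))}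

end AsymSeminorms

namespace AsymSeminorms

section Auxiliary

open Finset

variable {𝕜 : Type*} [RCLike 𝕜]

lemma le_sInf_pos_mul {p : ℝ → Prop} {T₀ : ℝ} (hT₀ : 0 < T₀) (hp : p T₀) {x y : ℝ} (hy : 0 ≤ y)
    (h : ∀ T, p T → x ≤ T * y) : x ≤ sInf {T : ℝ | 0 < T ∧ p T} * y := by
  rcases hy.eq_or_lt with rfl | hy
  · simpa using h T₀ hp
  · rw [← div_le_iff₀ hy]
    exact le_csInf ⟨T₀, hT₀, hp⟩ fun T hT => (div_le_iff₀ hy).2 (h T hT.2)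

lemma sInf_pos_le {p : ℝ → Prop} {T : ℝ} (hT : 0 < T) (h : p T) :
    sInf {T : ℝ | 0 < T ∧ p T} ≤ T :=
  csInf_le ⟨0, fun _ hx => hx.1.le⟩ ⟨hT, h⟩

lemma sInf_pos_nonneg {p : ℝ → Prop} : 0 ≤ sInf {T : ℝ | 0 < T ∧ p T} :=
  Real.sInf_nonneg fun _ hx => hx.1.le

lemma norm_le_lpnorm_top {n : ℕ} (a : Fin n → 𝕜) (i : Fin n) : ‖a i‖ ≤ lpnorm ∞ a := by
  simp only [lpnorm, if_true]
  exact le_ciSup (f := fun i => ‖a i‖) (Set.finite_range _).bddAbove i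

lemma lpnorm_nonneg (p : ℝ≥0∞) {n : ℕ} (a : Fin n → 𝕜) : 0 ≤ lpnorm p a := by
  unfold lpnorm
  split_ifs
  · exact Real.iSup_nonneg fun i => norm_nonneg _
  · positivity

lemma lpnorm_ofReal {p : ℝ} (hp : 1 < p) {n : ℕ} (a : Fin n → 𝕜) :
    lpnorm (ENNReal.ofReal p) a = (∑ i, ‖a i‖ ^ p) ^ (1 / p) := by
  rw [lpnorm, if_neg ENNReal.ofReal_ne_top, ENNReal.toReal_ofReal (by linarith)]

lemma lpnorm_le {p : ℝ} (hp : 1 < p) {n : ℕ} {a : Fin n → 𝕜} {s : ℝ} (hs : 0 ≤ s)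
    (h : ∀ i, ‖a i‖ ≤ s) :
    lpnorm (ENNReal.ofReal p) a ≤ (n : ℝ) ^ (1 / p) * s := by
  have hp0 : 0 < p := by linarith
  rw [lpnorm_ofReal hp]
  calc (∑ i, ‖a i‖ ^ p) ^ (1 / p) ≤ (∑ _i : Fin n, s ^ p) ^ (1 / p) := by
        gcongr with i
        exact h i
    _ = (n : ℝ) ^ (1 / p) * s := by
        rw [sum_const, card_univ, Fintype.card_fin, nsmul_eq_mul,
          Real.mul_rpow (by positivity) (by positivity), ← Real.rpow_mul hs,
          mul_one_div_cancel hp0.ne', Real.rpow_one]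

lemma le_lpnorm {p : ℝ} (hp : 1 < p) {n : ℕ} {a : Fin n → 𝕜} {s : ℝ} (hs : 0 ≤ s)
    (h : ∀ i, s ≤ ‖a i‖) :
    (n : ℝ) ^ (1 / p) * s ≤ lpnorm (ENNReal.ofReal p) a := by
  have hp0 : 0 < p := by linarith
  rw [lpnorm_ofReal hp]
  calc (n : ℝ) ^ (1 / p) * s = (∑ _i : Fin n, s ^ p) ^ (1 / p) := by
        rw [sum_const, card_univ, Fintype.card_fin, nsmul_eq_mul,
          Real.mul_rpow (by positivity) (by positivity), ← Real.rpow_mul hs,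
          mul_one_div_cancel hp0.ne', Real.rpow_one]
    _ ≤ (∑ i, ‖a i‖ ^ p) ^ (1 / p) := by
        gcongr with i
        exact h i

lemma norm_le_lpnorm {p : ℝ} (hp : 1 < p) {n : ℕ} (a : Fin n → 𝕜) (i : Fin n) :
    ‖a i‖ ≤ lpnorm (ENNReal.ofReal p) a := by
  have hp0 : 0 < p := by linarith
  rw [lpnorm_ofReal hp]
  calc ‖a i‖ = (‖a i‖ ^ p) ^ (1 / p) := by
        rw [← Real.rpow_mul (norm_nonneg _), mul_one_div_cancel hp0.ne', Real.rpow_one]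
    _ ≤ _ := by
        gcongr
        exact single_le_sum (f := fun i => ‖a i‖ ^ p) (fun i _ => by positivity) (mem_univ i)

/-- A member of `B_n^{a,b}` is dominated by the `ℓ_1` norm. -/
lemma MemB.fst_le_sum {ca cb : ℝ} {n : ℕ} {P : SNPair 𝕜 n} (hP : MemB ca cb P)
    (a : Fin n → 𝕜) : P.1 a ≤ ∑ i, ‖a i‖ := by
  have ha : a = ∑ i, a i • (Pi.single i 1 : Fin n → 𝕜) := by
    ext j
    simp [Finset.sum_apply, Pi.single_apply]
  calc P.1 a = P.1 (∑ i, a i • (Pi.single i 1 : Fin n → 𝕜)) := by rw [← ha]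
    _ ≤ ∑ i, P.1 (a i • (Pi.single i 1 : Fin n → 𝕜)) :=
        le_sum_of_subadditive _ (map_zero P.1).le (map_add_le_add _) _ _
    _ = ∑ i, ‖a i‖ := by simp [map_smul_eq_mul, hP.single_eq_one]

lemma MemB.fst_le_card_mul {ca cb : ℝ} {n : ℕ} {P : SNPair 𝕜 n} (hP : MemB ca cb P)
    {a : Fin n → 𝕜} {s : ℝ} (h : ∀ i, ‖a i‖ ≤ s) : P.1 a ≤ n * s := by
  refine (hP.fst_le_sum a).trans ((sum_le_sum fun i _ => h i).trans ?_)
  simp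

/-- The coordinate functionals are bounded by `2b`. -/
lemma MemB.norm_apply_le {ca cb : ℝ} {n : ℕ} {P : SNPair 𝕜 n} (hP : MemB ca cb P)
    (a : Fin n → 𝕜) (i : Fin n) : ‖a i‖ ≤ 2 * cb * P.1 a := by
  have h : a i • (Pi.single i 1 : Fin n → 𝕜) = trunc (i + 1) a - trunc i a := by
    ext j
    by_cases hij : j = i
    · subst hij; simp [trunc]
    · have h1 : (j : ℕ) ≠ i := fun h => hij (Fin.ext h)
      have h2 : ((j : ℕ) < i + 1) ↔ (j : ℕ) < i := by omega
      simp [trunc, hij, h2]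
  calc ‖a i‖ = P.1 (a i • (Pi.single i 1 : Fin n → 𝕜)) := by
        rw [map_smul_eq_mul, hP.single_eq_one, mul_one]
    _ = P.1 (trunc (i + 1) a - trunc i a) := by rw [h]
    _ ≤ P.1 (trunc (i + 1) a) + P.1 (trunc i a) := map_sub_le_add _ _ _
    _ ≤ cb * P.1 a + cb * P.1 a :=
        add_le_add (hP.trunc_fst _ i.2 a) (hP.trunc_fst _ i.2.le a)
    _ = 2 * cb * P.1 a := by ring

/-- On its `j`-th interval, a combination of the pieces of `a` is a multiple of `a`. -/
lemma sum_smul_piece_apply {n m : ℕ} (a : Fin n → 𝕜) {k : Fin (m + 1) → ℕ} (hk : StrictMono k)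
    (b : Fin m → 𝕜) (j : Fin m) {i : Fin n}
    (hi : k j.castSucc ≤ (i : ℕ) ∧ (i : ℕ) < k j.succ) :
    (∑ l : Fin m, b l • piece a k l) i = b j * a i := by
  rw [Finset.sum_apply, sum_eq_single j]
  · simp [piece, hi]
  · intro l _ hl
    have : ¬ (k l.castSucc ≤ (i : ℕ) ∧ (i : ℕ) < k l.succ) := by
      rintro ⟨h1, h2⟩
      rcases lt_or_gt_of_ne hl with h | h
      · have := hk.monotone (show l.succ ≤ j.castSucc from h)
        omega
      · have := hk.monotone (show j.succ ≤ l.castSucc from h)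
        omega
    simp [piece, this]
  · simp

lemma exists_mem_piece {m : ℕ} {k : Fin (m + 1) → ℕ} (hk0 : k 0 = 0) (t : Fin (m + 1)) {i : ℕ}
    (hi : i < k t) : ∃ j : Fin m, j.succ ≤ t ∧ k j.castSucc ≤ i ∧ i < k j.succ := by
  induction t using Fin.induction with
  | zero => omega
  | succ j ih =>
    by_cases h : i < k j.castSucc
    · obtain ⟨l, hl, hl'⟩ := ih h
      exact ⟨l, hl.trans (Fin.castSucc_lt_succ).le, hl'⟩
    · exact ⟨j, le_rfl, not_lt.1 h, hi⟩

lemma trunc_sum_smul_piece {n m : ℕ} (a : Fin n → 𝕜) {k : Fin (m + 1) → ℕ} (hk0 : k 0 = 0)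
    (hk : StrictMono k) (b : Fin m → 𝕜) (t : Fin (m + 1)) :
    ∑ j : Fin m, trunc (t : ℕ) b j • piece a k j
      = trunc (k t) (∑ j : Fin m, b j • piece a k j) := by
  ext i
  by_cases hi : (i : ℕ) < k (Fin.last m)
  · obtain ⟨j, -, hj⟩ := exists_mem_piece hk0 _ hi
    have hiff : (j : ℕ) < t ↔ (i : ℕ) < k t := by
      constructor
      · intro h
        exact hj.2.trans_le (hk.monotone (show j.succ ≤ t from h))
      · intro h
        by_contra h'
        have := hk.monotone (show t ≤ j.castSucc from not_lt.1 h')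
        omega
    rw [sum_smul_piece_apply a hk _ j hj, trunc, trunc, sum_smul_piece_apply a hk _ j hj]
    simp only [hiff]
    split_ifs <;> simp
  · have h0 : ∀ c : Fin m → 𝕜, (∑ j : Fin m, c j • piece a k j) i = 0 := by
      intro c
      rw [Finset.sum_apply]
      refine sum_eq_zero fun j _ => ?_
      have := hk.monotone (Fin.le_last j.succ)
      have : ¬ (k j.castSucc ≤ (i : ℕ) ∧ (i : ℕ) < k j.succ) := by omega
      simp [piece, this]
    rw [h0, trunc, h0, ite_self]

/-- The pieces of a block decomposition sum up to a truncation. -/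
lemma sum_piece {n m : ℕ} (a : Fin n → 𝕜) {k : Fin (m + 1) → ℕ} (hk0 : k 0 = 0)
    (hk : StrictMono k) : ∑ j : Fin m, piece a k j = trunc (k (Fin.last m)) a := by
  ext i
  by_cases hi : (i : ℕ) < k (Fin.last m)
  · obtain ⟨j, -, hj⟩ := exists_mem_piece hk0 _ hi
    have := sum_smul_piece_apply a hk (fun _ => 1) j hj
    simp only [one_smul, one_mul] at this
    rw [this, trunc, if_pos hi]
  · rw [Finset.sum_apply, trunc, if_neg hi]
    refine sum_eq_zero fun j _ => ?_
    have := hk.monotone (Fin.le_last j.succ)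
    have : ¬ (k j.castSucc ≤ (i : ℕ) ∧ (i : ℕ) < k j.succ) := by omega
    simp [piece, this]

/-- The pair of seminorms induced on `𝕜^m` by `m` vectors of `𝕜^n`. -/
def pullback {n m : ℕ} (P : SNPair 𝕜 n) (y : Fin m → Fin n → 𝕜) : SNPair 𝕜 m :=
  (P.1.comp (Fintype.linearCombination 𝕜 y), P.2.comp (Fintype.linearCombination 𝕜 y))

lemma memB_pullback {ca cb : ℝ} {n m : ℕ} {P : SNPair 𝕜 n} (hP : MemB ca cb P)
    (a : Fin n → 𝕜) {k : Fin (m + 1) → ℕ} (hk0 : k 0 = 0) (hk : StrictMono k)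
    (hkn : k (Fin.last m) ≤ n) (h1 : ∀ j, P.1 (piece a k j) = 1) :
    MemB ca cb (pullback P (piece a k)) where
  eq_zero_of x hx := by
    have hx' := hP.eq_zero_of _ hx
    ext j
    have hne : piece a k j ≠ 0 := fun h => by simpa [h] using h1 j
    obtain ⟨i, hi⟩ := Function.ne_iff.1 hne
    have hij : k j.castSucc ≤ (i : ℕ) ∧ (i : ℕ) < k j.succ := by
      by_contra h
      simp [piece, h] at hi
    have := congrFun hx' i
    rw [Fintype.linearCombination_apply, sum_smul_piece_apply a hk x j hij] at this
    simpa [piece, hij, show a i ≠ 0 by simpa [piece, hij] using hi] using this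
  single_eq_one j := by
    simp [pullback, Fintype.linearCombination_apply_single, h1]
  trunc_fst t ht b := by
    have := trunc_sum_smul_piece a hk0 hk b ⟨t, by omega⟩
    simp only [pullback, Seminorm.comp_apply, Fintype.linearCombination_apply] at this ⊢
    rw [this]
    exact hP.trunc_fst _ ((hk.monotone (Fin.le_last _)).trans hkn) _
  trunc_snd t ht b := by
    have := trunc_sum_smul_piece a hk0 hk b ⟨t, by omega⟩
    simp only [pullback, Seminorm.comp_apply, Fintype.linearCombination_apply] at this ⊢
    rw [this]
    exact hP.trunc_snd _ ((hk.monotone (Fin.le_last _)).trans hkn) _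
  snd_le x := hP.snd_le _

/-- Normalizing the nonzero pieces of a vector gives a block. -/
lemma StableFam.exists_block {ca cb : ℝ} {E : Fam 𝕜} (hE : StableFam ca cb E) {n m : ℕ}
    {P : SNPair 𝕜 n} (hP : P ∈ E n) (a : Fin n → 𝕜) {k : Fin (m + 1) → ℕ} (hk0 : k 0 = 0)
    (hk : StrictMono k) (hkn : k (Fin.last m) ≤ n) (hne : ∀ j, piece a k j ≠ 0) :
    ∃ Q ∈ E m, Q.1 (fun j => (P.1 (piece a k j) : 𝕜)) = P.1 (trunc (k (Fin.last m)) a) := by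
  have hPB := hE.1 n P hP
  have hpos : ∀ j, P.1 (piece a k j) ≠ 0 := fun j h => hne j (hPB.eq_zero_of _ h)
  set c : Fin m → 𝕜 := fun j => ((P.1 (piece a k j) : ℝ) : 𝕜) with hc
  have hc0 : ∀ j, c j ≠ 0 := fun j => by simpa [hc] using hpos j
  set a' : Fin n → 𝕜 := ∑ j, (c j)⁻¹ • piece a k j with ha'
  have hpiece : ∀ j, piece a' k j = (c j)⁻¹ • piece a k j := by
    intro j
    ext i
    by_cases hi : k j.castSucc ≤ (i : ℕ) ∧ (i : ℕ) < k j.succ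
    · have := sum_smul_piece_apply a hk (fun j => (c j)⁻¹) j hi
      simp only [piece, hi, and_self, if_true, Pi.smul_apply, smul_eq_mul]
      exact this
    · simp [piece, hi]
  have h1 : ∀ j, P.1 (piece a' k j) = 1 := by
    intro j
    rw [hpiece, map_smul_eq_mul, norm_inv, hc, RCLike.norm_ofReal,
      abs_of_nonneg (apply_nonneg _ _), inv_mul_cancel₀ (hpos j)]
  refine ⟨pullback P (piece a' k), hE.2.2 n m P hP _ (memB_pullback hPB a' hk0 hk hkn h1)
    ⟨a', k, hk0, hk, hkn, h1, fun b => ?_, fun b => ?_⟩, ?_⟩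
  · simp [pullback, Fintype.linearCombination_apply]
  · simp [pullback, Fintype.linearCombination_apply]
  · rw [← sum_piece a hk0 hk]
    simp only [pullback, Seminorm.comp_apply, Fintype.linearCombination_apply, hpiece]
    congr 1
    refine sum_congr rfl fun j _ => ?_
    rw [smul_smul]
    change (c j * (c j)⁻¹) • _ = _
    rw [mul_inv_cancel₀ (hc0 j), one_smul]

/-- The number of elements of `A` below `t`. -/
def countBelow {n : ℕ} (A : Finset (Fin n)) (t : ℕ) : ℕ := #(A.filter fun i : Fin n => (i : ℕ) < t)

lemma countBelow_mono {n : ℕ} (A : Finset (Fin n)) : Monotone (countBelow A) := by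
  intro s t h
  refine card_le_card fun i hi => ?_
  simp only [mem_filter] at hi ⊢
  exact ⟨hi.1, hi.2.trans_le h⟩

lemma countBelow_succ_le {n : ℕ} (A : Finset (Fin n)) (t : ℕ) :
    countBelow A (t + 1) ≤ countBelow A t + 1 := by
  have h : A.filter (fun i : Fin n => (i : ℕ) < t + 1)
      ⊆ A.filter (fun i : Fin n => (i : ℕ) < t) ∪ A.filter (fun i : Fin n => (i : ℕ) = t) := by
    intro i hi
    simp only [mem_filter, mem_union] at hi ⊢
    rcases Nat.lt_succ_iff_lt_or_eq.1 hi.2 with h | h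
    · exact Or.inl ⟨hi.1, h⟩
    · exact Or.inr ⟨hi.1, h⟩
  refine (card_le_card h).trans ((card_union_le _ _).trans ?_)
  gcongr
  · exact le_rfl
  · refine card_le_one.2 fun i hi j hj => ?_
    simp only [mem_filter] at hi hj
    exact Fin.ext (hi.2.trans hj.2.symm)

lemma exists_countBelow_eq {n : ℕ} (A : Finset (Fin n)) (t : ℕ) {v : ℕ}
    (hv : v ≤ countBelow A t) : ∃ s ≤ t, countBelow A s = v := by
  induction t with
  | zero => exact ⟨0, le_rfl, le_antisymm (by simp [countBelow]) hv⟩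
  | succ t ih =>
    by_cases h : v ≤ countBelow A t
    · obtain ⟨s, hs, hs'⟩ := ih h
      exact ⟨s, hs.trans t.le_succ, hs'⟩
    · exact ⟨t + 1, le_rfl, by have := countBelow_succ_le A t; omega⟩

lemma countBelow_self {n : ℕ} (A : Finset (Fin n)) : countBelow A n = #A := by
  rw [countBelow, filter_true_of_mem fun i _ => i.2]

/-- Cutting a vector into consecutive parts, with a prescribed number of elements of a set `A`
of nonzero coordinates in each part. -/
lemma StableFam.exists_block_of_counts {ca cb : ℝ} {E : Fam 𝕜} (hE : StableFam ca cb E)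
    {n m : ℕ} {P : SNPair 𝕜 n} (hP : P ∈ E n) (a : Fin n → 𝕜) (A : Finset (Fin n))
    (hA : ∀ i ∈ A, a i ≠ 0) (g : ℕ → ℕ) (hg0 : g 0 = 0) (hg : ∀ j < m, g j < g (j + 1))
    (hgm : g m ≤ #A) :
    ∃ Q ∈ E m, ∃ y : Fin m → Fin n → 𝕜, ∃ t ≤ n,
      Q.1 (fun j => (P.1 (y j) : 𝕜)) = P.1 (trunc t a) ∧
      (∀ j i, y j i = a i ∨ y j i = 0) ∧
      (∀ j : Fin m, #{i ∈ A | y j i ≠ 0} = g (j + 1) - g j) ∧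
      #(A.filter fun i : Fin n => (i : ℕ) < t) = g m := by
  have hg' : ∀ d j, j + d ≤ m → g j ≤ g (j + d) := by
    intro d
    induction d with
    | zero => intro j _; exact le_rfl
    | succ d ih =>
      intro j hj
      exact (ih j (by omega)).trans (hg (j + d) (by omega)).le
  have hex : ∀ j : Fin (m + 1), ∃ s ≤ n, countBelow A s = g j ∧ (j = 0 → s = 0) := by
    intro j
    by_cases hj : j = 0
    · exact ⟨0, n.zero_le, by simp [hj, hg0, countBelow], fun _ => rfl⟩
    · have h1 := hg' (m - j) j (by omega)
      rw [show (j : ℕ) + (m - j) = m by omega] at h1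
      obtain ⟨s, hs, hs'⟩ := exists_countBelow_eq A n (v := g j)
        (by rw [countBelow_self]; omega)
      exact ⟨s, hs, hs', fun h => absurd h hj⟩
  choose k hkn hkg hk0 using hex
  have hk : StrictMono k := by
    refine Fin.strictMono_iff_lt_succ.2 fun j => ?_
    by_contra h
    have h1 := countBelow_mono A (not_lt.1 h)
    rw [hkg, hkg] at h1
    have := hg j j.2
    simp only [Fin.val_castSucc, Fin.val_succ] at h1
    omega
  have hcard : ∀ j : Fin m, #{i ∈ A | piece a k j i ≠ 0} = g (j + 1) - g j := by
    intro j
    have h1 : ({i ∈ A | piece a k j i ≠ 0} : Finset (Fin n))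
        = A.filter (fun i : Fin n => (i : ℕ) < k j.succ)
          \ A.filter (fun i : Fin n => (i : ℕ) < k j.castSucc) := by
      ext i
      simp only [mem_filter, mem_sdiff]
      unfold piece
      constructor
      · rintro ⟨hi, h⟩
        have := ite_ne_right_iff.1 h
        exact ⟨⟨hi, this.1.2⟩, fun h' => by omega⟩
      · rintro ⟨⟨hi, h⟩, h'⟩
        refine ⟨hi, ?_⟩
        rw [if_pos ⟨not_lt.1 fun h2 => h' ⟨hi, h2⟩, h⟩]
        exact hA i hi
    rw [h1, card_sdiff_of_subset]
    · have e1 := hkg j.succ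
      have e2 := hkg j.castSucc
      rw [countBelow] at e1 e2
      rw [e1, e2]
      simp
    · intro i hi
      simp only [mem_filter] at hi ⊢
      exact ⟨hi.1, hi.2.trans (hk Fin.castSucc_lt_succ)⟩
  have hne : ∀ j, piece a k j ≠ 0 := by
    intro j h
    have h1 := hcard j
    have := hg j j.2
    simp only [h, Pi.zero_apply, ne_eq, not_true_eq_false, filter_false, card_empty] at h1
    omega
  obtain ⟨Q, hQ, hQ'⟩ := hE.exists_block hP a (hk0 0 rfl) hk (hkn _) hne
  refine ⟨Q, hQ, piece a k, k (Fin.last m), hkn _, hQ', fun j i => ?_, hcard, ?_⟩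
  · unfold piece
    split_ifs <;> simp
  · simpa [countBelow] using hkg (Fin.last m)

end Auxiliary

section PowerType

open Finset

variable {𝕜 : Type*} [RCLike 𝕜]

/-- Iterating an upper estimate for `N` successive blocks. -/
lemma StableFam.upper_pow {ca cb : ℝ} {E : Fam 𝕜} (hE : StableFam ca cb E) {N : ℕ}
    {T : ℝ} (hT : 0 ≤ T)
    (h : ∀ m ≤ N, ∀ Q ∈ E m, ∀ c : Fin m → 𝕜, ∀ s : ℝ, 0 ≤ s → (∀ j, ‖c j‖ ≤ s) → Q.1 c ≤ T * s)
    (k : ℕ) {n : ℕ} {P : SNPair 𝕜 n} (hP : P ∈ E n) (a : Fin n → 𝕜) {s : ℝ} (hs : 0 ≤ s)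
    (ha : ∀ i, ‖a i‖ ≤ s) (hcard : #{i | a i ≠ 0} ≤ N ^ k) : P.1 a ≤ T ^ k * s := by
  induction k generalizing n P a s with
  | zero =>
    refine ((hE.1 n P hP).fst_le_sum a).trans ?_
    rw [pow_zero, one_mul]
    rw [pow_zero, card_le_one] at hcard
    by_cases h0 : ∃ i, a i ≠ 0
    · obtain ⟨i, hi⟩ := h0
      rw [sum_eq_single i]
      · exact ha i
      · intro j _ hj
        by_contra hj'
        exact hj (hcard j (by simpa using hj') i (by simpa using hi))
      · simp
    · push Not at h0
      simpa [h0] using hs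
  | succ k ih =>
    set A : Finset (Fin n) := {i | a i ≠ 0} with hA
    rcases Nat.eq_zero_or_pos (N ^ k) with hz | hm
    · have hA0 : A = ∅ := by
        rw [← card_eq_zero]
        rw [pow_succ, hz, zero_mul] at hcard
        omega
      have : a = 0 := by
        ext i
        by_contra hi
        have : i ∈ A := by simpa [hA] using hi
        simp [hA0] at this
      rw [this, map_zero]
      positivity
    set m := N ^ k with hmdef
    set M := (#A + m - 1) / m with hM
    have hMN : M ≤ N := by
      rw [pow_succ, ← hmdef] at hcard
      have h1 : #A + m - 1 < m * (N + 1) := by rw [mul_add]; omega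
      have := Nat.div_lt_of_lt_mul h1
      omega
    have hAM : #A ≤ M * m := by
      have := Nat.lt_div_mul_add (a := #A + m - 1) hm
      rw [← hM] at this
      omega
    have hlt : ∀ j < M, j * m < #A := by
      intro j hj
      have h1 : M * m ≤ #A + m - 1 := Nat.div_mul_le_self _ _
      have h2 : (j + 1) * m ≤ M * m := Nat.mul_le_mul_right m hj
      rw [add_mul] at h2
      omega
    obtain ⟨Q, hQ, y, t, -, hQy, hy, hyA, htA⟩ :=
      hE.exists_block_of_counts hP a A (fun i hi => by simpa [hA] using hi)
        (fun j => min (j * m) #A) (by simp)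
        (m := M) (fun j hj => by have := hlt j hj; simp only [add_mul]; omega) (min_le_right _ _)
    have htr : trunc t a = a := by
      have h1 : #(A.filter fun i : Fin n => (i : ℕ) < t) = #A := by rw [htA, min_eq_right hAM]
      have h2 := eq_of_subset_of_card_le (filter_subset _ _) h1.ge
      ext i
      by_cases hi : a i = 0
      · simp [trunc, hi]
      · have : i ∈ A := by simpa [hA] using hi
        rw [← h2, mem_filter] at this
        simp [trunc, this.2]
    rw [htr] at hQy
    rw [← hQy]
    have hyP : ∀ j, P.1 (y j) ≤ T ^ k * s := by
      intro j
      refine ih hP (y j) hs (fun i => ?_) ?_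
      · rcases hy j i with h | h <;> rw [h]
        · exact ha i
        · simpa using hs
      · have h1 : ({i | y j i ≠ 0} : Finset (Fin n)) ⊆ {i ∈ A | y j i ≠ 0} := by
          intro i hi
          simp only [mem_filter, mem_univ, true_and, hA] at hi ⊢
          refine ⟨?_, hi⟩
          rcases hy j i with h | h
          · rwa [← h]
          · exact absurd h hi
        refine (card_le_card h1).trans ?_
        rw [hyA]
        simp only [add_mul]
        omega
    have := h M hMN Q hQ (fun j => (P.1 (y j) : 𝕜)) (T ^ k * s) (by positivity) fun j => by
      rw [RCLike.norm_ofReal, abs_of_nonneg (apply_nonneg _ _)]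
      exact hyP j
    rw [pow_succ', mul_assoc]
    exact this

/-- Iterating a lower estimate for `N` successive blocks. -/
lemma StableFam.lower_pow {ca cb : ℝ} (hcb : 1 ≤ cb) {E : Fam 𝕜}
    (hE : StableFam ca cb E) {N : ℕ} (hN : 1 ≤ N)
    (h : ∀ Q ∈ E N, ∀ c : Fin N → 𝕜, ∀ s : ℝ, 0 ≤ s → (∀ j, s ≤ ‖c j‖) → 2 * cb * s ≤ Q.1 c)
    (k : ℕ) {n : ℕ} {P : SNPair 𝕜 n} (hP : P ∈ E n) (a : Fin n → 𝕜) {s : ℝ} (hs : 0 < s)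
    (hcard : N ^ k ≤ #{i | s ≤ ‖a i‖}) : 2 ^ k * s ≤ 2 * cb * P.1 a := by
  induction k generalizing n P a s with
  | zero =>
    rw [pow_zero, one_le_card] at hcard
    obtain ⟨i, hi⟩ := hcard
    rw [pow_zero, one_mul]
    exact (mem_filter.1 hi).2.trans ((hE.1 n P hP).norm_apply_le a i)
  | succ k ih =>
    have hcb0 : 0 < cb := by linarith
    set A : Finset (Fin n) := {i | s ≤ ‖a i‖} with hA
    have hm : 0 < N ^ k := by positivity
    obtain ⟨Q, hQ, y, t, htn, hQy, hy, hyA, -⟩ :=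
      hE.exists_block_of_counts hP a A
        (fun i hi h0 => by
          have h1 := (mem_filter.1 hi).2
          rw [h0, norm_zero] at h1
          linarith)
        (fun j => j * N ^ k) (by simp)
        (m := N) (fun j _ => by simp only [add_mul]; omega) (by rwa [pow_succ'] at hcard)
    have hyP : ∀ j, 2 ^ k * s / (2 * cb) ≤ P.1 (y j) := by
      intro j
      rw [div_le_iff₀' (by positivity)]
      refine ih hP (y j) hs ?_
      have h1 : ({i ∈ A | y j i ≠ 0} : Finset (Fin n)) ⊆ ({i | s ≤ ‖y j i‖} : Finset (Fin n)) := by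
        intro i hi
        simp only [mem_filter, mem_univ, true_and, hA] at hi ⊢
        rcases hy j i with h | h
        · rw [h]; exact hi.1
        · exact absurd h hi.2
      refine le_trans ?_ (card_le_card h1)
      rw [hyA]
      simp only [add_mul]
      omega
    have h1 := h Q hQ (fun j => (P.1 (y j) : 𝕜)) (2 ^ k * s / (2 * cb)) (by positivity) fun j => by
      rw [RCLike.norm_ofReal, abs_of_nonneg (apply_nonneg _ _)]
      exact hyP j
    rw [hQy, mul_div_cancel₀ _ (by positivity)] at h1
    have h2 := h1.trans ((hE.1 n P hP).trunc_fst t htn a)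
    rw [pow_succ]
    linarith

/-- A finite family of nonzero vectors is bounded below by a term of a geometric sequence. -/
lemma exists_pow_mul_lt_norm {n : ℕ} (a : Fin n → 𝕜) {l : ℝ} (hl0 : 0 ≤ l) (hl1 : l < 1) (s : ℝ) :
    ∃ K : ℕ, ∀ i, a i ≠ 0 → l ^ K * s < ‖a i‖ := by
  have h : ∀ i, ∀ᶠ K : ℕ in Filter.atTop, a i ≠ 0 → l ^ K * s < ‖a i‖ := by
    intro i
    by_cases hi : a i = 0
    · simp [hi]
    · have h1 : Filter.Tendsto (fun K : ℕ => l ^ K * s) Filter.atTop (nhds 0) := by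
        simpa using (tendsto_pow_atTop_nhds_zero_of_lt_one hl0 hl1).mul_const s
      filter_upwards [h1.eventually_lt_const (norm_pos_iff.2 hi)] with K hK _ using hK
  exact (Filter.eventually_all.2 h).exists

/-- A geometric upper estimate on vectors with bounded support gives an `ℓ_p` upper estimate. -/
lemma upper_lp_of_upper_pow {n : ℕ} {P : SNPair 𝕜 n} {N : ℕ}
    (hN : 1 ≤ N) {T l p : ℝ} (hT : 0 ≤ T) (hl0 : 0 < l) (hl1 : l < 1) (hTl : T * l < 1)
    (hp : 1 < p) (hlp : l ^ p = (N : ℝ)⁻¹)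
    (h : ∀ k : ℕ, ∀ a : Fin n → 𝕜, ∀ s : ℝ, 0 ≤ s → (∀ i, ‖a i‖ ≤ s) → #{i | a i ≠ 0} ≤ N ^ k →
      P.1 a ≤ T ^ k * s) (a : Fin n → 𝕜) :
    P.1 a ≤ T / (1 - T * l) * lpnorm (ENNReal.ofReal p) a := by
  have hp0 : 0 < p := by linarith
  set s := lpnorm (ENNReal.ofReal p) a with hs
  have hN0 : (0 : ℝ) < N := by exact_mod_cast hN
  have hle : ∀ i, ‖a i‖ ≤ s := norm_le_lpnorm hp a
  have hs0 : 0 ≤ s := lpnorm_nonneg _ _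
  rcases hs0.eq_or_lt with h0 | hspos
  · have : a = 0 := by
      ext i
      have := hle i
      rw [← h0] at this
      simpa using this
    rw [← h0, this]
    simp
  have hsum : ∑ i, ‖a i‖ ^ p = s ^ p := by
    rw [hs, lpnorm_ofReal hp, ← Real.rpow_mul (by positivity), one_div_mul_cancel hp0.ne',
      Real.rpow_one]
  have hcount : ∀ K : ℕ, #{i | l ^ K * s < ‖a i‖} ≤ N ^ K := by
    intro K
    have h1 : (#{i | l ^ K * s < ‖a i‖} : ℝ) * (l ^ K * s) ^ p ≤ s ^ p := by
      rw [← hsum, ← nsmul_eq_mul, ← sum_const]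
      refine (sum_le_sum fun i hi => ?_).trans
        (sum_le_sum_of_subset_of_nonneg (filter_subset _ _) fun i _ _ => by positivity)
      exact Real.rpow_le_rpow (by positivity) (mem_filter.1 hi).2.le hp0.le
    have h2 : (l ^ K * s) ^ p = ((N : ℝ) ^ K)⁻¹ * s ^ p := by
      rw [Real.mul_rpow (by positivity) hs0, ← Real.rpow_natCast l K, ← Real.rpow_mul hl0.le,
        mul_comm (K : ℝ) p, Real.rpow_mul hl0.le, hlp, Real.rpow_natCast, inv_pow]
    have h3 : 0 < s ^ p := by positivity
    rw [h2, ← mul_assoc, mul_le_iff_le_one_left h3, ← div_eq_mul_inv,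
      div_le_one (by positivity)] at h1
    exact_mod_cast h1
  have hlevel : ∀ K : ℕ, P.1 (fun i => if l ^ K * s < ‖a i‖ then a i else 0)
      ≤ T * s * ∑ k ∈ range K, (T * l) ^ k := by
    intro K
    induction K with
    | zero =>
      have : (fun i => if l ^ 0 * s < ‖a i‖ then a i else 0) = 0 := by
        ext i
        simp [(hle i).not_gt]
      rw [this]
      simp
    | succ K ih =>
      have hsplit : (fun i => if l ^ (K + 1) * s < ‖a i‖ then a i else 0)
          = (fun i => if l ^ K * s < ‖a i‖ then a i else 0)
            + fun i => if l ^ (K + 1) * s < ‖a i‖ ∧ ‖a i‖ ≤ l ^ K * s then a i else 0 := by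
        ext i
        have hmono : l ^ (K + 1) * s ≤ l ^ K * s := by
          gcongr ?_ * s
          exact pow_le_pow_of_le_one hl0.le hl1.le K.le_succ
        simp only [Pi.add_apply]
        by_cases h1 : l ^ K * s < ‖a i‖
        · simp [h1, hmono.trans_lt h1, h1.not_ge]
        · simp [h1, not_lt.1 h1]
      rw [hsplit, sum_range_succ, mul_add]
      refine (map_add_le_add _ _ _).trans (add_le_add ih ?_)
      have := h (K + 1) (fun i => if l ^ (K + 1) * s < ‖a i‖ ∧ ‖a i‖ ≤ l ^ K * s then a i else 0)
        (l ^ K * s) (by positivity) (fun i => by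
          split_ifs with hi
          · exact hi.2
          · rw [norm_zero]; positivity) (by
          refine (card_le_card fun i hi => ?_).trans (hcount (K + 1))
          simp only [mem_filter, mem_univ, true_and] at hi ⊢
          exact (ite_ne_right_iff.1 hi).1.1)
      refine this.trans_eq ?_
      rw [mul_pow]
      ring
  obtain ⟨K, hK⟩ := exists_pow_mul_lt_norm a hl0.le hl1 s
  have haK : (fun i => if l ^ K * s < ‖a i‖ then a i else 0) = a := by
    ext i
    by_cases hi : a i = 0
    · simp [hi]
    · simp [hK i hi]
  have h1 := hlevel K
  rw [haK] at h1
  have h2 : ∑ k ∈ range K, (T * l) ^ k ≤ (1 - T * l)⁻¹ := by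
    rw [← tsum_geometric_of_lt_one (by positivity) hTl]
    exact (summable_geometric_of_lt_one (by positivity) hTl).sum_le_tsum _
      fun k _ => by positivity
  calc P.1 a ≤ T * s * ∑ k ∈ range K, (T * l) ^ k := h1
    _ ≤ T * s * (1 - T * l)⁻¹ := by gcongr
    _ = T / (1 - T * l) * s := by rw [div_eq_mul_inv]; ring

/-- A geometric lower estimate on vectors with many large coordinates gives an `ℓ_q` lower
estimate. -/
lemma lower_lq_of_lower_pow {ca cb : ℝ} (hcb : 1 ≤ cb) {n : ℕ} {P : SNPair 𝕜 n}
    (hP : MemB ca cb P) {N q : ℕ} (hN : 1 ≤ N) (hq : 1 < q) (hNq : N < 2 ^ q)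
    (h : ∀ k : ℕ, ∀ a : Fin n → 𝕜, ∀ s : ℝ, 0 < s → N ^ k ≤ #{i | s ≤ ‖a i‖} →
      2 ^ k * s ≤ 2 * cb * P.1 a) (a : Fin n → 𝕜) :
    lpnorm (ENNReal.ofReal q) a
      ≤ 4 * cb * ((N : ℝ) * (1 - N * (1 / 2) ^ q : ℝ)⁻¹) ^ (1 / (q : ℝ)) * P.1 a := by
  have hq' : (1 : ℝ) < q := by exact_mod_cast hq
  have hρ : (N * (1 / 2) ^ q : ℝ) < 1 := by
    have : (N : ℝ) < 2 ^ q := by exact_mod_cast hNq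
    rw [one_div, inv_pow, ← div_eq_mul_inv, div_lt_one (by positivity)]
    exact this
  set R := 4 * cb * P.1 a with hR
  have hPa : 0 ≤ P.1 a := apply_nonneg _ _
  have hR0 : 0 ≤ R := by positivity
  have hle : ∀ i, ‖a i‖ ≤ R := by
    intro i
    refine (hP.norm_apply_le a i).trans ?_
    rw [hR]
    gcongr
    norm_num
  rcases hR0.eq_or_lt with h0 | hRpos
  · have : a = 0 := by
      ext i
      have := hle i
      rw [← h0] at this
      simpa using this
    subst this
    rw [map_zero, mul_zero]
    refine (lpnorm_le hq' le_rfl fun i => by simp).trans ?_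
    simp
  have hcount : ∀ K : ℕ, #{i | (1 / 2) ^ K * R < ‖a i‖} ≤ N ^ K := by
    intro K
    by_contra hlt
    push Not at hlt
    have h1 := h K a ((1 / 2) ^ K * R) (by positivity)
      (hlt.le.trans (card_le_card fun i hi => by
        simp only [mem_filter, mem_univ, true_and] at hi ⊢
        exact hi.le))
    rw [← mul_assoc, ← mul_pow] at h1
    norm_num at h1
    rw [hR] at h1 hRpos
    linarith
  have hlevel : ∀ K : ℕ, ∑ i with (1 / 2) ^ K * R < ‖a i‖, ‖a i‖ ^ q
      ≤ N * R ^ q * ∑ k ∈ range K, (N * (1 / 2) ^ q : ℝ) ^ k := by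
    intro K
    induction K with
    | zero =>
      rw [filter_false_of_mem fun i _ => by simpa using hle i]
      simp
    | succ K ih =>
      have hsplit : ({i | (1 / 2) ^ (K + 1) * R < ‖a i‖} : Finset (Fin n))
          ⊆ ({i | (1 / 2) ^ K * R < ‖a i‖} : Finset (Fin n))
            ∪ ({i | (1 / 2) ^ (K + 1) * R < ‖a i‖ ∧ ‖a i‖ ≤ (1 / 2) ^ K * R} : Finset (Fin n)) := by
        intro i hi
        simp only [mem_filter, mem_univ, true_and, mem_union] at hi ⊢
        rcases lt_or_ge ((1 / 2) ^ K * R) ‖a i‖ with h1 | h1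
        · exact Or.inl h1
        · exact Or.inr ⟨hi, h1⟩
      have hdisj : Disjoint ({i | (1 / 2) ^ K * R < ‖a i‖} : Finset (Fin n))
          ({i | (1 / 2) ^ (K + 1) * R < ‖a i‖ ∧ ‖a i‖ ≤ (1 / 2) ^ K * R} : Finset (Fin n)) := by
        refine disjoint_left.2 fun i hi hi' => ?_
        simp only [mem_filter, mem_univ, true_and] at hi hi'
        exact hi.not_ge hi'.2
      refine (sum_le_sum_of_subset_of_nonneg hsplit fun i _ _ => by positivity).trans ?_
      rw [sum_union hdisj, sum_range_succ, mul_add]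
      refine add_le_add ih ?_
      refine (sum_le_card_nsmul _ _ (((1 / 2) ^ K * R) ^ q) fun i hi => ?_).trans ?_
      · simp only [mem_filter, mem_univ, true_and] at hi
        gcongr
        exact hi.2
      · have h1 : #{i | (1 / 2) ^ (K + 1) * R < ‖a i‖ ∧ ‖a i‖ ≤ (1 / 2) ^ K * R} ≤ N ^ (K + 1) := by
          refine (card_le_card fun i hi => ?_).trans (hcount (K + 1))
          simp only [mem_filter, mem_univ, true_and] at hi ⊢
          exact hi.1
        have h2 : (#{i | (1 / 2) ^ (K + 1) * R < ‖a i‖ ∧ ‖a i‖ ≤ (1 / 2) ^ K * R} : ℝ)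
            ≤ (N : ℝ) ^ (K + 1) := by exact_mod_cast h1
        rw [nsmul_eq_mul]
        calc _ ≤ (N : ℝ) ^ (K + 1) * ((1 / 2) ^ K * R) ^ q := by gcongr
          _ = N * R ^ q * (N * (1 / 2) ^ q : ℝ) ^ K := by
            rw [mul_pow ((1 / 2) ^ K) R, mul_pow (N : ℝ), ← pow_mul, ← pow_mul, mul_comm K q]
            ring
  obtain ⟨K, hK⟩ := exists_pow_mul_lt_norm a (l := 1 / 2) (by norm_num) (by norm_num) R
  have hsum : ∑ i, ‖a i‖ ^ q = ∑ i with (1 / 2) ^ K * R < ‖a i‖, ‖a i‖ ^ q := by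
    symm
    refine sum_filter_of_ne fun i _ hi => hK i fun h0 => hi ?_
    rw [h0, norm_zero, zero_pow (by omega)]
  have h2 : ∑ k ∈ range K, (N * (1 / 2) ^ q : ℝ) ^ k ≤ (1 - N * (1 / 2) ^ q : ℝ)⁻¹ := by
    rw [← tsum_geometric_of_lt_one (by positivity) hρ]
    exact (summable_geometric_of_lt_one (by positivity) hρ).sum_le_tsum _
      fun k _ => by positivity
  have hρ' : (0 : ℝ) ≤ (1 - N * (1 / 2) ^ q : ℝ)⁻¹ := inv_nonneg.2 (by linarith)
  have h3 : ∑ i, ‖a i‖ ^ q ≤ N * (1 - N * (1 / 2) ^ q : ℝ)⁻¹ * R ^ q := by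
    rw [hsum]
    calc _ ≤ _ := hlevel K
      _ ≤ N * R ^ q * (1 - N * (1 / 2) ^ q : ℝ)⁻¹ := by gcongr
      _ = _ := by ring
  rw [lpnorm_ofReal hq']
  simp only [Real.rpow_natCast]
  calc (∑ i, ‖a i‖ ^ q) ^ (1 / (q : ℝ))
      ≤ (N * (1 - N * (1 / 2) ^ q : ℝ)⁻¹ * R ^ q) ^ (1 / (q : ℝ)) := by gcongr
    _ = ((N : ℝ) * (1 - N * (1 / 2) ^ q : ℝ)⁻¹) ^ (1 / (q : ℝ)) * R := by
        rw [Real.mul_rpow (by positivity) (by positivity), one_div (q : ℝ),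
          Real.pow_rpow_inv_natCast hR0 (by omega)]
    _ = _ := by rw [hR]; ring

end PowerType

section Constants

variable {𝕜 : Type*} [RCLike 𝕜] {ca cb : ℝ} {E : Fam 𝕜} {n : ℕ} {P : SNPair 𝕜 n}

lemma IdentityBlockFam.snd_le_alphaC_mul (hE : IdentityBlockFam ca cb E) (hP : P ∈ E n)
    {p : ℝ} (hp : 1 < p) (a : Fin n → 𝕜) :
    P.2 a ≤ alphaC (ENNReal.ofReal p) E n * lpnorm (ENNReal.ofReal p) a := by
  refine le_sInf_pos_mul (T₀ := n + 1) (by positivity) (fun P hP a => ?_) (lpnorm_nonneg _ _)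
    fun T hT => hT P hP a
  rw [← hE.2 n P hP]
  refine ((hE.1.1 n P hP).fst_le_card_mul (norm_le_lpnorm hp a)).trans ?_
  have := lpnorm_nonneg (ENNReal.ofReal p) a
  gcongr
  linarith

lemma IdentityBlockFam.snd_le_thetaC_mul (hE : IdentityBlockFam ca cb E) (hP : P ∈ E n)
    (a : Fin n → 𝕜) : P.2 ((n : 𝕜)⁻¹ • a) ≤ thetaC E n * lpnorm ∞ a := by
  refine le_sInf_pos_mul (T₀ := 1) (by positivity) (fun P hP a => ?_) (lpnorm_nonneg _ _)
    fun T hT => hT P hP a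
  rw [← hE.2 n P hP, map_smul_eq_mul, norm_inv, RCLike.norm_natCast, one_mul]
  rcases Nat.eq_zero_or_pos n with h0 | hn
  · subst h0
    simpa using lpnorm_nonneg ∞ a
  · rw [inv_mul_le_iff₀ (by exact_mod_cast hn)]
    exact (hE.1.1 n P hP).fst_le_card_mul (norm_le_lpnorm_top a)

lemma IdentityBlockFam.snd_single (hE : IdentityBlockFam ca cb E) (hP : P ∈ E n) (i : Fin n) :
    P.2 (Pi.single i 1) = 1 := by
  rw [← hE.2 n P hP, (hE.1.1 n P hP).single_eq_one]

lemma IdentityBlockFam.lpnorm_le_betaC_mul (hE : IdentityBlockFam ca cb E) (hcb : 1 ≤ cb)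
    (hP : P ∈ E n) {q : ℝ} (hq : 1 < q) (a : Fin n → 𝕜) :
    lpnorm (ENNReal.ofReal q) a ≤ betaC (ENNReal.ofReal q) E n * P.1 a := by
  refine le_sInf_pos_mul (T₀ := (n : ℝ) ^ (1 / q) * (2 * cb) + 1) (by positivity) (fun P hP a => ?_)
    (apply_nonneg _ _) fun T hT => ?_
  · simp only [hE.snd_single hP, RCLike.ofReal_one, mul_one]
    refine (lpnorm_le hq (by positivity) ((hE.1.1 n P hP).norm_apply_le a)).trans ?_
    have := apply_nonneg P.1 a
    linarith
  · simpa [hE.snd_single hP] using hT P hP a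

lemma IdentityBlockFam.iInf_le_upsC_mul (hE : IdentityBlockFam ca cb E) (hcb : 1 ≤ cb)
    (hP : P ∈ E n) (a : Fin n → 𝕜) : ⨅ i, ‖a i‖ ≤ upsC E n * P.1 a := by
  refine le_sInf_pos_mul (T₀ := 2 * cb) (by positivity) (fun P hP a => ?_)
    (apply_nonneg _ _) fun T hT => ?_
  · simp only [hE.snd_single hP, mul_one]
    rcases isEmpty_or_nonempty (Fin n) with h | ⟨⟨i⟩⟩
    · rw [Real.iInf_of_isEmpty]
      have := apply_nonneg P.1 a
      positivity
    · exact (ciInf_le (Set.finite_range _).bddBelow i).trans ((hE.1.1 n P hP).norm_apply_le a i)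
  · simpa [hE.snd_single hP] using hT P hP a

lemma IdentityBlockFam.exists_alphaC_le (hE : IdentityBlockFam ca cb E)
    (h : Filter.Tendsto (fun n : ℕ => thetaC E n) Filter.atTop (nhds 0)) :
    ∃ p : ℝ, 1 < p ∧ ∃ C : ℝ, ∀ n : ℕ, 1 ≤ n → alphaC (ENNReal.ofReal p) E n ≤ C := by
  obtain ⟨n₀, hn₀⟩ := Filter.eventually_atTop.1
    (h.eventually_le_const (show (0 : ℝ) < 1 / 2 by norm_num))
  set N := 2 * (n₀ + 1) with hN
  have hN2 : (2 : ℝ) ≤ N := by rw [hN]; push_cast; linarith [n₀.cast_nonneg (α := ℝ)]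
  have hbase : ∀ m ≤ N, ∀ Q ∈ E m, ∀ c : Fin m → 𝕜, ∀ s : ℝ, 0 ≤ s → (∀ j, ‖c j‖ ≤ s) →
      Q.1 c ≤ (N / 2 : ℝ) * s := by
    intro m hm Q hQ c s hs hc
    by_cases hmn : m < n₀ + 1
    · refine ((hE.1.1 m Q hQ).fst_le_card_mul hc).trans ?_
      gcongr
      rw [hN]
      push_cast
      have : (m : ℝ) ≤ n₀ + 1 := by exact_mod_cast hmn.le
      linarith
    · have hm0 : (0 : ℝ) < m := by
        have : 0 < m := by omega
        exact_mod_cast this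
      have h1 := hE.snd_le_thetaC_mul hQ c
      rw [← hE.2 m Q hQ, map_smul_eq_mul, norm_inv, RCLike.norm_natCast,
        inv_mul_le_iff₀ hm0] at h1
      have h2 : lpnorm ∞ c ≤ s := by
        simp only [lpnorm, if_true]
        exact Real.iSup_le hc hs
      have h3 := hn₀ m (by omega)
      have h4 := lpnorm_nonneg ∞ c
      have h5 : 0 ≤ thetaC E m := sInf_pos_nonneg
      calc Q.1 c ≤ m * (thetaC E m * lpnorm ∞ c) := h1
        _ ≤ N * (1 / 2 * s) := by gcongr
        _ = _ := by ring
  set r : ℝ := 1 - (N : ℝ)⁻¹ with hr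
  have hNinv : (N : ℝ)⁻¹ ≤ 2⁻¹ := inv_anti₀ (by norm_num) hN2
  have hNinv0 : 0 < (N : ℝ)⁻¹ := by positivity
  have hr0 : 0 < r := by rw [hr]; linarith
  have hr1 : r < 1 := by rw [hr]; linarith
  set l : ℝ := (N : ℝ)⁻¹ ^ r with hl
  have hl0 : 0 < l := by positivity
  have hl1 : l < 1 := Real.rpow_lt_one hNinv0.le (by linarith) hr0
  have hlr : l ^ r⁻¹ = (N : ℝ)⁻¹ := by
    rw [hl, ← Real.rpow_mul hNinv0.le, mul_inv_cancel₀ hr0.ne', Real.rpow_one]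
  have hTl : (N / 2 : ℝ) * l < 1 := by
    have h1 : (N : ℝ) * l = (N : ℝ) ^ (N : ℝ)⁻¹ := by
      rw [hl, hr, Real.inv_rpow (by positivity), Real.rpow_sub (by positivity), Real.rpow_one]
      field_simp
    have h2 : (N : ℝ) ^ (N : ℝ)⁻¹ < 2 := by
      rw [Real.rpow_inv_lt_iff_of_pos (by positivity) (by norm_num) (by positivity),
        Real.rpow_natCast]
      exact_mod_cast Nat.lt_two_pow_self
    linarith
  have hp : 1 < r⁻¹ := (one_lt_inv₀ hr0).2 hr1
  refine ⟨r⁻¹, hp, (N / 2 : ℝ) / (1 - (N / 2 : ℝ) * l), fun n _ => ?_⟩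
  refine sInf_pos_le (div_pos (by positivity) (by linarith)) fun P hP a => ?_
  rw [← hE.2 n P hP]
  exact upper_lp_of_upper_pow (N := N) (by omega) (by positivity) hl0 hl1 hTl hp
    hlr (fun k a s hs ha hcard =>
      hE.1.upper_pow (by positivity) hbase k hP a hs ha hcard) a

lemma IdentityBlockFam.tendsto_thetaC (hE : IdentityBlockFam ca cb E) {p : ℝ} (hp : 1 < p)
    {C : ℝ} (hC : ∀ n : ℕ, 1 ≤ n → alphaC (ENNReal.ofReal p) E n ≤ C) :
    Filter.Tendsto (fun n : ℕ => thetaC E n) Filter.atTop (nhds 0) := by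
  have hp0 : 0 < 1 - 1 / p := by
    have : 1 / p < 1 := (div_lt_one (by linarith)).2 hp
    linarith
  have hlim : Filter.Tendsto (fun n : ℕ => (|C| + 1) * (n : ℝ) ^ (-(1 - 1 / p)))
      Filter.atTop (nhds 0) := by
    simpa using ((tendsto_rpow_neg_atTop hp0).comp tendsto_natCast_atTop_atTop).const_mul (|C| + 1)
  refine squeeze_zero' (Filter.Eventually.of_forall fun n => sInf_pos_nonneg) ?_ hlim
  filter_upwards [Filter.eventually_ge_atTop 1] with n hn
  have hn0 : (0 : ℝ) < n := by exact_mod_cast hn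
  refine sInf_pos_le (by positivity) fun P hP a => ?_
  have h0 := lpnorm_nonneg ∞ a
  have h1 := lpnorm_le hp h0 (norm_le_lpnorm_top a)
  rw [map_smul_eq_mul, norm_inv, RCLike.norm_natCast]
  calc (n : ℝ)⁻¹ * P.2 a
      ≤ (n : ℝ)⁻¹ * ((|C| + 1) * ((n : ℝ) ^ (1 / p) * lpnorm ∞ a)) := by
        gcongr
        refine (hE.snd_le_alphaC_mul hP hp a).trans ?_
        gcongr
        · exact lpnorm_nonneg _ _
        · linarith [hC n hn, le_abs_self C]
    _ = (|C| + 1) * (n : ℝ) ^ (-(1 - 1 / p)) * lpnorm ∞ a := by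
        rw [neg_sub, Real.rpow_sub_one hn0.ne']
        ring

lemma IdentityBlockFam.exists_betaC_le (hE : IdentityBlockFam ca cb E) (hcb : 1 ≤ cb)
    (h : Filter.Tendsto (fun n : ℕ => upsC E n) Filter.atTop (nhds 0)) :
    ∃ q : ℝ, 1 < q ∧ ∃ C : ℝ, ∀ n : ℕ, 1 ≤ n → betaC (ENNReal.ofReal q) E n ≤ C := by
  obtain ⟨n₀, hn₀⟩ := Filter.eventually_atTop.1
    (h.eventually_le_const (show (0 : ℝ) < (2 * cb)⁻¹ by positivity))
  set N := n₀ + 1 with hN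
  have hbase : ∀ Q ∈ E N, ∀ c : Fin N → 𝕜, ∀ s : ℝ, 0 ≤ s → (∀ j, s ≤ ‖c j‖) →
      2 * cb * s ≤ Q.1 c := by
    intro Q hQ c s hs hc
    rw [← le_inv_mul_iff₀ (by positivity)]
    have : Nonempty (Fin N) := ⟨0⟩
    have h1 := hn₀ N (by omega)
    calc s ≤ ⨅ i, ‖c i‖ := le_ciInf hc
      _ ≤ upsC E N * Q.1 c := hE.iInf_le_upsC_mul hcb hQ c
      _ ≤ _ := by gcongr
  have hNq : N < 2 ^ (N + 1) :=
    Nat.lt_two_pow_self.trans (Nat.pow_lt_pow_right (by norm_num) N.lt_succ_self)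
  refine ⟨(N + 1 : ℕ), by norm_cast; omega,
    4 * cb * ((N : ℝ) * (1 - N * (1 / 2) ^ (N + 1) : ℝ)⁻¹) ^ (1 / ((N + 1 : ℕ) : ℝ)), fun n _ => ?_⟩
  have hρ : (N * (1 / 2) ^ (N + 1) : ℝ) < 1 := by
    have : (N : ℝ) < 2 ^ (N + 1) := by exact_mod_cast hNq
    rw [one_div, inv_pow, ← div_eq_mul_inv, div_lt_one (by positivity)]
    exact this
  have hN0 : (0 : ℝ) < N := by rw [hN]; positivity
  have hinv : 0 < (1 - N * (1 / 2) ^ (N + 1) : ℝ)⁻¹ := inv_pos.2 (by linarith)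
  refine sInf_pos_le (by positivity) fun P hP a => ?_
  simp only [hE.snd_single hP, RCLike.ofReal_one, mul_one]
  exact lower_lq_of_lower_pow hcb (hE.1.1 n P hP) (by omega) (by omega) hNq
    (fun k a s hs hcard =>
      hE.1.lower_pow hcb (by omega) hbase k hP a hs hcard) a

lemma IdentityBlockFam.tendsto_upsC (hE : IdentityBlockFam ca cb E) (hcb : 1 ≤ cb) {q : ℝ}
    (hq : 1 < q) {C : ℝ} (hC : ∀ n : ℕ, 1 ≤ n → betaC (ENNReal.ofReal q) E n ≤ C) :
    Filter.Tendsto (fun n : ℕ => upsC E n) Filter.atTop (nhds 0) := by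
  have hlim : Filter.Tendsto (fun n : ℕ => (|C| + 1) * (n : ℝ) ^ (-(1 / q)))
      Filter.atTop (nhds 0) := by
    simpa using ((tendsto_rpow_neg_atTop (show 0 < 1 / q by positivity)).comp
      tendsto_natCast_atTop_atTop).const_mul (|C| + 1)
  refine squeeze_zero' (Filter.Eventually.of_forall fun n => sInf_pos_nonneg) ?_ hlim
  filter_upwards [Filter.eventually_ge_atTop 1] with n hn
  have hn0 : (0 : ℝ) < n := by exact_mod_cast hn
  refine sInf_pos_le (by positivity) fun P hP a => ?_
  simp only [hE.snd_single hP, mul_one]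
  have h1 := le_lpnorm hq (a := a) (s := ⨅ i, ‖a i‖) (Real.iInf_nonneg fun i => norm_nonneg _)
    fun i => ciInf_le (Set.finite_range _).bddBelow i
  have h2 : lpnorm (ENNReal.ofReal q) a ≤ (|C| + 1) * P.1 a := by
    refine (hE.lpnorm_le_betaC_mul hcb hP hq a).trans ?_
    gcongr
    linarith [hC n hn, le_abs_self C]
  rw [Real.rpow_neg hn0.le, mul_assoc, mul_left_comm, le_inv_mul_iff₀ (by positivity)]
  exact h1.trans h2

end Constants

/-- Corollary 2.9, `automatic power type`: an identity block has block
basic subtype iff it has nontrivial block basic type, and block basic subcotype iff it has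
nontrivial block basic cotype. -/
theorem subtype_iff_nontrivial_type {𝕜 : Type*} [RCLike 𝕜]
    (ca cb : ℝ) (hca : 0 ≤ ca) (hcb : 1 ≤ cb)
    (E : Fam 𝕜) (hE : IdentityBlockFam ca cb E) :
    (Filter.Tendsto (fun n : ℕ => thetaC E n) Filter.atTop (nhds 0) ↔
      ∃ p : ℝ, 1 < p ∧ ∃ C : ℝ, ∀ n : ℕ, 1 ≤ n → alphaC (ENNReal.ofReal p) E n ≤ C) ∧
    (Filter.Tendsto (fun n : ℕ => upsC E n) Filter.atTop (nhds 0) ↔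
      ∃ q : ℝ, 1 < q ∧ ∃ C : ℝ, ∀ n : ℕ, 1 ≤ n → betaC (ENNReal.ofReal q) E n ≤ C) := by
  exact ⟨⟨hE.exists_alphaC_le, fun ⟨_, hp, _, hC⟩ => hE.tendsto_thetaC hp hC⟩,
    hE.exists_betaC_le hcb, fun ⟨_, hq, _, hC⟩ => hE.tendsto_upsC hcb hq hC⟩

end AsymSeminorms
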